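/- arXiv:2311.15221 — 2 statements merged into one kernel-verified Lean document; each statement's English description precedes it below -/
import Mathlib

section
/- There exist absolute constants C, c > 0 such that the following holds. Let t > 0 and let a = (a₁, …, a_n) ∈ R^n satisfy ‖a‖₂ ≤ C √n and ‖a‖_∞ ≤ C t, and let X₁, …, X_n be i.i.d. N(0, I_d) random vectors. Then for any ε > 0, with probability at least 1 − C e^{C d − c n min(ε², ε/t)}, one has sup_{u, v ∈ S^{d−1}} | (1/n) Σ_{i=1}^n a_i (u^⊤ X_i)(v^⊤ X_i) − ((1/n) Σ_{i=1}^n a_i) u^⊤ v | ≤ ε. -/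
open MeasureTheory ProbabilityTheory Real

noncomputable section

/-- Euclidean inner product on `Fin d → ℝ`. -/
def dot {d : ℕ} (u v : Fin d → ℝ) : ℝ := ∑ j, u j * v j

/-- Euclidean norm on `Fin d → ℝ`. -/
def nrm {d : ℕ} (u : Fin d → ℝ) : ℝ := Real.sqrt (∑ j, (u j) ^ 2)

/-- Standard Gaussian `N(0, I_d)` on `Fin d → ℝ`. -/
def stdGaussian (d : ℕ) : Measure (Fin d → ℝ) := Measure.pi fun _ => gaussianReal 0 1

/-- Law of `n` i.i.d. draws from `N(0, I_d)`. -/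
def sample (n d : ℕ) : Measure (Fin n → Fin d → ℝ) := Measure.pi fun _ => stdGaussian d

lemma aux_exp_ineq {x : ℝ} (h2 : x ≤ 1/2) : rexp (-x - x^2) ≤ 1 - x := by
  have hk : 1 ≤ (1 - x) * rexp (x + x^2) := by
    rcases le_total x 0 with hx | hx
    · have h := Real.add_one_le_exp (x + x^2)
      have : 0 ≤ -x^3 := by
        have : 0 ≤ (-x)^3 := by apply pow_nonneg; linarith
        nlinarith
      nlinarith
    · have h := Real.quadratic_le_exp_of_nonneg (x := x + x^2) (by positivity)
      have h3 : (1 - x) * (1 + (x + x^2) + (x+x^2)^2/2) ≤ (1 - x) * rexp (x + x^2) :=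
        mul_le_mul_of_nonneg_left h (by linarith)
      have h4 : 2 * x ≤ (1 - x) * (1 + x)^2 := by
        nlinarith [mul_nonneg hx (sub_nonneg.2 h2), mul_nonneg (mul_nonneg hx hx) (sub_nonneg.2 h2)]
      have h5 : 0 ≤ x^2 * ((1 - x) * (1 + x)^2 - 2 * x) :=
        mul_nonneg (sq_nonneg _) (by linarith)
      nlinarith
  have : rexp (-x - x^2) = (rexp (x + x^2))⁻¹ := by
    rw [← Real.exp_neg]; congr 1; ring
  rw [this]
  have hp := Real.exp_pos (x + x^2)
  rw [inv_le_iff_one_le_mul₀ hp]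
  exact hk

lemma aux_gauss_int (l : ℝ) (hl : |l| ≤ 1/4) :
    Integrable (fun g : ℝ => rexp (l * (g^2 - 1))) (gaussianReal 0 1) ∧
    ∫ g, rexp (l * (g^2 - 1)) ∂(gaussianReal 0 1) ≤ rexp (2 * l^2) := by
  obtain ⟨hl1, hl2⟩ := abs_le.1 hl
  have hb : 0 < 1/2 - l := by linarith
  have key : ∀ g : ℝ, gaussianPDFReal 0 1 g • rexp (l * (g^2 - 1))
      = ((√(2 * π))⁻¹ * rexp (-l)) * rexp (-(1/2 - l) * g^2) := by
    intro g
    simp only [gaussianPDFReal, smul_eq_mul, NNReal.coe_one, mul_one, sub_zero]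
    rw [mul_assoc, mul_assoc, ← Real.exp_add, ← Real.exp_add]
    congr 2; ring
  constructor
  · rw [gaussianReal_of_var_ne_zero _ one_ne_zero,
      integrable_withDensity_iff_integrable_smul₀' (by fun_prop)
        (by simp [gaussianPDF])]
    have : (fun g : ℝ => (gaussianPDF 0 1 g).toReal • rexp (l * (g^2 - 1))) =
        fun g => ((√(2 * π))⁻¹ * rexp (-l)) * rexp (-(1/2 - l) * g^2) := by
      funext g; rw [toReal_gaussianPDF, key]
    rw [this]
    exact (integrable_exp_neg_mul_sq hb).const_mul _
  · rw [integral_gaussianReal_eq_integral_smul one_ne_zero]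
    simp_rw [key]
    rw [integral_const_mul, integral_gaussian]
    have h1 := aux_exp_ineq (x := 2 * l) (by linarith)
    have e : π / (1/2 - l) = 2 * π / (1 - 2 * l) := by
      field_simp
    rw [e, Real.sqrt_div (by positivity)]
    have h2 : rexp (-l - 2 * l^2) ≤ √(1 - 2 * l) := by
      apply Real.le_sqrt_of_sq_le
      rw [← Real.exp_nat_mul]
      refine le_trans (le_of_eq ?_) h1
      congr 1; push_cast; ring
    have h3 : 0 < √(1 - 2 * l) := Real.sqrt_pos.2 (by linarith)
    have h4 : 0 < √(2 * π) := Real.sqrt_pos.2 (by positivity)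
    have : (√(2 * π))⁻¹ * rexp (-l) * (√(2 * π) / √(1 - 2 * l)) = rexp (-l) / √(1 - 2 * l) := by
      field_simp
    rw [this, div_le_iff₀ h3]
    calc rexp (-l) = rexp (2 * l^2) * rexp (-l - 2 * l^2) := by
          rw [← Real.exp_add]; congr 1; ring
      _ ≤ _ := by gcongr

instance aux_prob_std (d : ℕ) : IsProbabilityMeasure (_root_.stdGaussian d) := by
  unfold _root_.stdGaussian; infer_instance

instance aux_prob_sample (n d : ℕ) : IsProbabilityMeasure (sample n d) := by
  unfold sample; infer_instance

lemma nrm_sq {d : ℕ} (u : Fin d → ℝ) : nrm u ^ 2 = dot u u := by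
  unfold nrm dot
  rw [Real.sq_sqrt (Finset.sum_nonneg fun _ _ => sq_nonneg _)]
  simp [pow_two]

lemma nrm_nonneg {d : ℕ} (u : Fin d → ℝ) : 0 ≤ nrm u := Real.sqrt_nonneg _

lemma cont_dot {d : ℕ} : Continuous (fun p : (Fin d → ℝ) × (Fin d → ℝ) => dot p.1 p.2) := by
  unfold dot; fun_prop

lemma cont_nrm {d : ℕ} : Continuous (fun p : (Fin d → ℝ) => nrm p) := by
  unfold nrm; fun_prop

lemma cont_dot_left {d : ℕ} (w : Fin d → ℝ) : Continuous (fun x : Fin d → ℝ => dot w x) := by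
  unfold dot; fun_prop

lemma aux_law {d : ℕ} (w : Fin d → ℝ) :
    (_root_.stdGaussian d).map (dot w) = (gaussianReal 0 1).map (fun g => nrm w * g) := by
  have hm : Measurable (dot w) := (cont_dot_left w).measurable
  have : IsProbabilityMeasure ((_root_.stdGaussian d).map (dot w)) :=
    Measure.isProbabilityMeasure_map hm.aemeasurable
  have : IsProbabilityMeasure ((gaussianReal 0 1).map (fun g => nrm w * g)) :=
    Measure.isProbabilityMeasure_map (by fun_prop)
  apply Measure.ext_of_charFun
  funext t
  rw [charFun_map_mul, charFun_gaussianReal, charFun_apply_real,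
    integral_map hm.aemeasurable (by fun_prop)]
  have h1 : ∀ x : Fin d → ℝ, Complex.exp (t * (dot w x : ℝ) * Complex.I)
      = ∏ j, Complex.exp ((t * w j : ℝ) * x j * Complex.I) := by
    intro x
    rw [← Complex.exp_sum]
    congr 1
    unfold dot
    push_cast
    rw [Finset.mul_sum, Finset.sum_mul]
    exact Finset.sum_congr rfl fun j _ => by ring
  simp_rw [h1]
  unfold _root_.stdGaussian
  rw [integral_fintype_prod_eq_prod (μ := fun _ : Fin d => gaussianReal 0 1) (f := fun j (y : ℝ) => Complex.exp ((t * w j : ℝ) * y * Complex.I))]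
  simp_rw [← charFun_apply_real, charFun_gaussianReal]
  rw [← Complex.exp_sum]
  congr 1
  have := nrm_sq w
  unfold dot at this
  have h2 : ((nrm w : ℝ) : ℂ)^2 = ∑ j, (w j : ℂ) * w j := by
    rw [← Complex.ofReal_pow, this]; push_cast; rfl
  push_cast
  rw [mul_pow, h2]
  simp only [mul_zero, zero_mul, zero_sub, Finset.sum_neg_distrib, one_mul]
  rw [← Finset.sum_div, Finset.sum_mul]
  congr 2
  refine Finset.sum_congr rfl fun j _ => by ring

lemma aux_single {d : ℕ} (w : Fin d → ℝ) (hw : nrm w ^ 2 ≤ 2) (b : ℝ) (hb : |b| * 2 ≤ 1/4) :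
    Integrable (fun y => rexp (b * (dot w y ^ 2 - nrm w ^ 2))) (_root_.stdGaussian d) ∧
    ∫ y, rexp (b * (dot w y ^ 2 - nrm w ^ 2)) ∂(_root_.stdGaussian d) ≤ rexp (8 * b^2) := by
  have hm : Measurable (dot w) := (cont_dot_left w).measurable
  have hl : |b * nrm w ^ 2| ≤ 1/4 := by
    rw [abs_mul, abs_of_nonneg (sq_nonneg (nrm w))]
    nlinarith [abs_nonneg b]
  obtain ⟨h1, h2⟩ := aux_gauss_int (b * nrm w ^ 2) hl
  have e : ∀ g : ℝ, rexp (b * nrm w ^ 2 * (g^2 - 1)) =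
      rexp (b * ((nrm w * g)^2 - nrm w^2)) := by
    intro g; congr 1; ring
  simp_rw [e] at h1 h2
  have hc : Continuous (fun z : ℝ => rexp (b * (z^2 - nrm w^2))) := by fun_prop
  have i1 : Integrable (fun z : ℝ => rexp (b * (z^2 - nrm w^2)))
      ((gaussianReal 0 1).map (fun g => nrm w * g)) := by
    rw [integrable_map_measure hc.aestronglyMeasurable (by fun_prop)]
    exact h1
  have i2 : ∫ z, rexp (b * (z^2 - nrm w^2)) ∂((gaussianReal 0 1).map (fun g => nrm w * g))
      ≤ rexp (2 * (b * nrm w ^ 2)^2) := by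
    rw [integral_map (by fun_prop) hc.aestronglyMeasurable]
    exact h2
  rw [← aux_law] at i1 i2
  rw [integrable_map_measure hc.aestronglyMeasurable hm.aemeasurable] at i1
  rw [integral_map hm.aemeasurable hc.aestronglyMeasurable] at i2
  refine ⟨i1, i2.trans ?_⟩
  apply Real.exp_le_exp.2
  have : (nrm w ^ 2)^2 ≤ 4 := by nlinarith [sq_nonneg (nrm w)]
  rw [mul_pow]
  nlinarith [sq_nonneg b]

lemma aux_chernoff {n d : ℕ} (a : Fin n → ℝ) (w : Fin d → ℝ) (hw : nrm w ^ 2 ≤ 2) (s : ℝ)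
    (hs : 0 < s) (hb : ∀ i, |s * a i| * 2 ≤ 1/4) (τ : ℝ) :
    sample n d {x | τ ≤ ∑ i, a i * (dot w (x i) ^ 2 - nrm w ^ 2)} ≤
      ENNReal.ofReal (rexp (8 * s^2 * ∑ i, a i ^ 2 - s * τ)) := by
  have hint : Integrable (fun x : Fin n → Fin d → ℝ =>
      ∏ i, rexp ((s * a i) * (dot w (x i) ^ 2 - nrm w ^ 2))) (sample n d) :=
    Integrable.fintype_prod (μ := fun _ : Fin n => _root_.stdGaussian d)
      (f := fun i y => rexp ((s * a i) * (dot w y ^ 2 - nrm w ^ 2)))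
      (fun i => (aux_single w hw _ (hb i)).1)
  have hI : ∫ x : Fin n → Fin d → ℝ,
      ∏ i, rexp ((s * a i) * (dot w (x i) ^ 2 - nrm w ^ 2)) ∂(sample n d) ≤
        rexp (8 * s^2 * ∑ i, a i ^ 2) := by
    unfold sample
    rw [integral_fintype_prod_eq_prod (μ := fun _ : Fin n => _root_.stdGaussian d)
      (f := fun i y => rexp ((s * a i) * (dot w y ^ 2 - nrm w ^ 2)))]
    calc _ ≤ ∏ i, rexp (8 * (s * a i)^2) :=
          Finset.prod_le_prod (fun i _ => integral_nonneg fun _ => (Real.exp_pos _).le)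
            (fun i _ => (aux_single w hw _ (hb i)).2)
      _ = _ := by
          rw [← Real.exp_sum, Finset.mul_sum]
          congr 1
          exact Finset.sum_congr rfl fun i _ => by ring
  have hp : ∀ x : Fin n → Fin d → ℝ, ∏ i, rexp ((s * a i) * (dot w (x i) ^ 2 - nrm w ^ 2))
      = rexp (s * ∑ i, a i * (dot w (x i) ^ 2 - nrm w ^ 2)) := by
    intro x
    rw [← Real.exp_sum, Finset.mul_sum]
    congr 1
    exact Finset.sum_congr rfl fun i _ => by ring
  simp_rw [hp] at hint hI
  have h := ProbabilityTheory.measure_ge_le_exp_mul_mgf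
    (X := fun x : Fin n → Fin d → ℝ => ∑ i, a i * (dot w (x i) ^ 2 - nrm w ^ 2))
    (μ := sample n d) τ hs.le hint
  rw [← ENNReal.ofReal_toReal (measure_ne_top (sample n d) _)]
  apply ENNReal.ofReal_le_ofReal
  refine (le_of_eq rfl).trans (h.trans ?_)
  rw [mgf, sub_eq_add_neg, add_comm, Real.exp_add, ← neg_mul]
  gcongr

lemma aux_tail {n d : ℕ} (a : Fin n → ℝ) (w : Fin d → ℝ) (hw : nrm w ^ 2 ≤ 2) (s : ℝ)
    (hs : 0 < s) (hb : ∀ i, |s * a i| * 2 ≤ 1/4) (τ : ℝ) :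
    sample n d {x | τ < |∑ i, a i * (dot w (x i) ^ 2 - nrm w ^ 2)|} ≤
      2 * ENNReal.ofReal (rexp (8 * s^2 * ∑ i, a i ^ 2 - s * τ)) := by
  have h1 := aux_chernoff a w hw s hs hb τ
  have h2 := aux_chernoff (fun i => - a i) w hw s hs (by simpa using hb) τ
  simp only [neg_mul, Finset.sum_neg_distrib, neg_sq] at h2
  rw [two_mul]
  refine le_trans (measure_mono ?_) ((measure_union_le _ _).trans (add_le_add h1 h2))
  intro x hx
  rw [Set.mem_ofPred_eq] at hx
  rcases lt_abs.1 hx with h | h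
  · exact Or.inl h.le
  · exact Or.inr h.le

/-- The bilinear form. -/
def auxB {n d : ℕ} (a : Fin n → ℝ) (x : Fin n → Fin d → ℝ) (u v : Fin d → ℝ) : ℝ :=
  (1 / n) * ∑ i, a i * (dot u (x i)) * (dot v (x i)) - ((1 / n) * ∑ i, a i) * dot u v

lemma auxB_diag {n d : ℕ} (a : Fin n → ℝ) (x : Fin n → Fin d → ℝ) (w : Fin d → ℝ) :
    auxB a x w w = (1 / n) * ∑ i, a i * (dot w (x i) ^ 2 - nrm w ^ 2) := by
  unfold auxB
  rw [nrm_sq, mul_assoc, ← mul_sub, Finset.sum_mul, ← Finset.sum_sub_distrib]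
  congr 1
  exact Finset.sum_congr rfl fun i _ => by ring

lemma dot_add_left {d : ℕ} (u v w : Fin d → ℝ) : dot (u + v) w = dot u w + dot v w := by
  simp [dot, add_mul, Finset.sum_add_distrib]

lemma dot_smul_left {d : ℕ} (r : ℝ) (u w : Fin d → ℝ) : dot (r • u) w = r * dot u w := by
  simp [dot, Finset.mul_sum, mul_assoc]

lemma dot_comm' {d : ℕ} (u w : Fin d → ℝ) : dot u w = dot w u := by
  simp [dot, mul_comm]

lemma auxB_comm {n d : ℕ} (a : Fin n → ℝ) (x : Fin n → Fin d → ℝ) (u v : Fin d → ℝ) :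
    auxB a x u v = auxB a x v u := by
  unfold auxB
  rw [dot_comm' u v]
  congr 2
  exact Finset.sum_congr rfl fun i _ => by ring

lemma auxB_add {n d : ℕ} (a : Fin n → ℝ) (x : Fin n → Fin d → ℝ) (u u' v : Fin d → ℝ) :
    auxB a x (u + u') v = auxB a x u v + auxB a x u' v := by
  unfold auxB
  simp only [dot_add_left, mul_add, add_mul, Finset.sum_add_distrib]
  ring

lemma auxB_smul {n d : ℕ} (a : Fin n → ℝ) (x : Fin n → Fin d → ℝ) (r : ℝ) (u v : Fin d → ℝ) :
    auxB a x (r • u) v = r * auxB a x u v := by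
  have : ∀ i, a i * (r * dot u (x i)) * dot v (x i) = r * (a i * dot u (x i) * dot v (x i)) :=
    fun i => by ring
  unfold auxB
  simp only [dot_smul_left, this, ← Finset.mul_sum]
  ring

lemma auxB_cont {n d : ℕ} (a : Fin n → ℝ) :
    Continuous (fun p : (Fin n → Fin d → ℝ) × (Fin d → ℝ) => auxB a p.1 p.2 p.2) := by
  unfold auxB dot; fun_prop

lemma auxB_add_add {n d : ℕ} (a : Fin n → ℝ) (x : Fin n → Fin d → ℝ) (u v : Fin d → ℝ) (r : ℝ) :
    auxB a x (u + r • v) (u + r • v) =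
      auxB a x u u + 2 * r * auxB a x u v + r^2 * auxB a x v v := by
  rw [auxB_add, auxB_comm a x u (u + r • v), auxB_comm a x (r • v) (u + r • v), auxB_add, auxB_add,
    auxB_smul, auxB_comm a x u (r • v), auxB_smul, auxB_comm a x (r • v) (r • v), auxB_smul,
    auxB_comm a x v (r • v), auxB_smul, auxB_comm a x v u]
  ring

lemma nrm_sq_add {d : ℕ} (u v : Fin d → ℝ) (r : ℝ) :
    nrm (u + r • v) ^ 2 = nrm u ^ 2 + 2 * r * dot u v + r^2 * nrm v ^ 2 := by
  simp only [nrm_sq]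
  rw [dot_add_left, dot_comm' u (u + r • v), dot_smul_left, dot_comm' v (u + r • v), dot_add_left,
    dot_add_left, dot_smul_left, dot_smul_left, dot_comm' v u]
  ring

lemma nrm_smul {d : ℕ} (u : Fin d → ℝ) (r : ℝ) : nrm (r • u) = |r| * nrm u := by
  have : ∑ j, (r • u) j ^ 2 = r^2 * ∑ j, u j ^ 2 := by
    simp [mul_pow, Finset.mul_sum]
  unfold nrm
  rw [this, Real.sqrt_mul (sq_nonneg _), Real.sqrt_sq_eq_abs]

lemma abs_le_nrm {d : ℕ} (u : Fin d → ℝ) (j : Fin d) : |u j| ≤ nrm u := by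
  unfold nrm
  apply Real.le_sqrt_of_sq_le
  rw [sq_abs]
  exact Finset.single_le_sum (f := fun j => u j ^ 2) (fun _ _ => sq_nonneg _) (Finset.mem_univ j)

lemma norm_le_nrm {d : ℕ} (u : Fin d → ℝ) : ‖u‖ ≤ nrm u :=
  (pi_norm_le_iff_of_nonneg (nrm_nonneg u)).2 fun j => abs_le_nrm u j

lemma eq_zero_of_nrm {d : ℕ} {u : Fin d → ℝ} (h : nrm u = 0) : u = 0 := by
  have := norm_le_nrm u
  rw [h] at this
  exact norm_le_zero_iff.1 this

/-- If the form is large somewhere, it is large on a ball of radius `1/8`. -/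
lemma aux_bad {n d : ℕ} (a : Fin n → ℝ) (x : Fin n → Fin d → ℝ) (ε : ℝ) (hε : 0 < ε)
    (u v : Fin d → ℝ) (hu : nrm u = 1) (hv : nrm v = 1) (h : ε < |auxB a x u v|) :
    ∃ u0 : Fin d → ℝ, nrm u0 = 1 ∧ ∀ y : Fin d → ℝ, nrm y < 1 →
      ε / 2 < |auxB a x (u0 + (1/8 : ℝ) • y) (u0 + (1/8 : ℝ) • y)| := by
  have hcpt : IsCompact {w : Fin d → ℝ | nrm w = 1} := by
    apply Metric.isCompact_of_isClosed_isBounded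
    · exact isClosed_eq cont_nrm continuous_const
    · refine (Metric.isBounded_closedBall (x := (0 : Fin d → ℝ)) (r := 1)).subset ?_
      intro w hw
      simpa [← show nrm w = 1 from hw] using norm_le_nrm w
  have hc : Continuous (fun w : Fin d → ℝ => |auxB a x w w|) :=
    ((auxB_cont a).comp (continuous_const.prodMk continuous_id)).abs
  obtain ⟨u0, hu0, hmax⟩ := hcpt.exists_isMaxOn ⟨u, hu⟩ hc.continuousOn
  set q := |auxB a x u0 u0| with hq
  have hu0 : nrm u0 = 1 := hu0
  have hQ : ∀ z : Fin d → ℝ, |auxB a x z z| ≤ q * nrm z ^ 2 := by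
    intro z
    by_cases hz : nrm z = 0
    · have := eq_zero_of_nrm hz
      rw [hz, auxB_diag, this]
      simp [dot, nrm]
    · have hz' : 0 < nrm z := lt_of_le_of_ne (nrm_nonneg z) (Ne.symm hz)
      have hm : nrm ((nrm z)⁻¹ • z) = 1 := by
        rw [nrm_smul, abs_of_pos (inv_pos.2 hz')]; field_simp
      have hle : |auxB a x ((nrm z)⁻¹ • z) ((nrm z)⁻¹ • z)| ≤ q := hmax hm
      rw [auxB_smul, auxB_comm, auxB_smul, ← mul_assoc, abs_mul,
        abs_of_pos (by positivity)] at hle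
      calc |auxB a x z z| = ((nrm z)⁻¹ * (nrm z)⁻¹ * |auxB a x z z|) * nrm z ^ 2 := by
            field_simp
        _ ≤ _ := by gcongr
  have hB : ∀ y z : Fin d → ℝ, |auxB a x y z| ≤ q * (nrm y ^ 2 + nrm z ^ 2) / 2 := by
    intro y z
    have e1 := auxB_add_add a x y z 1
    have e2 := auxB_add_add a x y z (-1)
    have n1 := nrm_sq_add y z 1
    have n2 := nrm_sq_add y z (-1)
    have q1 := abs_le.1 (hQ (y + (1 : ℝ) • z))
    have q2 := abs_le.1 (hQ (y + (-1 : ℝ) • z))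
    rw [e1, n1] at q1
    rw [e2, n2] at q2
    rw [abs_le]
    constructor <;> nlinarith
  have hqe : ε < q := by
    have := hB u v
    rw [hu, hv] at this
    linarith
  refine ⟨u0, hu0, fun y hy => ?_⟩
  have hy2 : nrm y ^ 2 ≤ 1 := by nlinarith [nrm_nonneg y]
  have b1 := hB u0 y
  rw [hu0] at b1
  have b1' : |auxB a x u0 y| ≤ q := by nlinarith
  have b2 : |auxB a x y y| ≤ q := by nlinarith [hQ y]
  rw [auxB_add_add]
  obtain ⟨c1, c2⟩ := abs_le.1 b1'
  obtain ⟨c3, c4⟩ := abs_le.1 b2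
  rcases abs_cases (auxB a x u0 u0) with ⟨g, _⟩ | ⟨g, _⟩
  · refine lt_of_lt_of_le ?_ (le_abs_self _)
    linarith
  · refine lt_of_lt_of_le ?_ (neg_le_abs _)
    linarith

open scoped Pointwise in
lemma aux_vol {d : ℕ} (c : Fin d → ℝ) (r : ℝ) (hr : 0 < r) :
    volume {w : Fin d → ℝ | nrm (r⁻¹ • (w - c)) < 1} =
      ENNReal.ofReal (r ^ d) * volume {y : Fin d → ℝ | nrm y < 1} := by
  have h1 : {w : Fin d → ℝ | nrm (r⁻¹ • (w - c)) < 1} =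
      (fun w => (-c) + w) ⁻¹' (r • {y : Fin d → ℝ | nrm y < 1}) := by
    ext w
    rw [Set.mem_preimage, Set.mem_smul_set_iff_inv_smul_mem₀ hr.ne']
    simp only [Set.mem_ofPred_eq, neg_add_eq_sub]
  rw [h1, measure_preimage_add, Measure.addHaar_smul]
  simp [abs_of_pos hr]

lemma aux_vol_pos (d : ℕ) : volume {y : Fin d → ℝ | nrm y < 1} ≠ 0 := by
  have ho : IsOpen {y : Fin d → ℝ | nrm y < 1} := isOpen_lt cont_nrm continuous_const
  exact (ho.measure_pos volume ⟨0, by simp [nrm]⟩).ne'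

lemma aux_vol_fin (d : ℕ) : volume {y : Fin d → ℝ | nrm y < 1} ≠ ⊤ := by
  have hb : Bornology.IsBounded {y : Fin d → ℝ | nrm y < 1} := by
    refine (Metric.isBounded_closedBall (x := (0 : Fin d → ℝ)) (r := 1)).subset ?_
    intro w hw
    have hw : nrm w < 1 := hw
    simpa using (norm_le_nrm w).trans hw.le
  exact hb.measure_lt_top.ne

lemma aux_union {n d : ℕ} (a : Fin n → ℝ) (ε : ℝ) (hε : 0 < ε) (p : ENNReal)
    (hp : ∀ w : Fin d → ℝ, nrm w ^ 2 ≤ 2 → sample n d {x | ε / 2 < |auxB a x w w|} ≤ p) :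
    sample n d {x | ∃ u v : Fin d → ℝ, nrm u = 1 ∧ nrm v = 1 ∧ ε < |auxB a x u v|} ≤
      p * ENNReal.ofReal (12 ^ d) := by
  set V := volume {y : Fin d → ℝ | nrm y < 1} with hV
  set S : Set ((Fin n → Fin d → ℝ) × (Fin d → ℝ)) :=
    {z | nrm z.2 ^ 2 < 2 ∧ ε / 2 < |auxB a z.1 z.2 z.2|} with hS
  have hSo : IsOpen S :=
    (isOpen_lt ((cont_nrm.comp continuous_snd).pow 2) continuous_const).inter
      (isOpen_lt continuous_const (auxB_cont a).abs)
  have hSm : MeasurableSet S := hSo.measurableSet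
  have low : ∀ x ∈ {x : Fin n → Fin d → ℝ | ∃ u v : Fin d → ℝ, nrm u = 1 ∧ nrm v = 1 ∧
      ε < |auxB a x u v|}, ENNReal.ofReal ((1/8) ^ d) * V ≤ volume (Prod.mk x ⁻¹' S) := by
    rintro x ⟨u, v, hu, hv, h⟩
    obtain ⟨u0, hu0, hy⟩ := aux_bad a x ε hε u v hu hv h
    rw [hV, ← aux_vol u0 (1/8) (by norm_num)]
    apply measure_mono
    intro w hw
    set y := (1/8 : ℝ)⁻¹ • (w - u0) with hydef
    have hy1 : nrm y < 1 := hw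
    have hwy : w = u0 + (1/8 : ℝ) • y := by
      rw [hydef, smul_smul]; norm_num
    refine ⟨?_, ?_⟩
    · change nrm w ^ 2 < 2
      have n0 := nrm_sq_add u0 y (1/8)
      have n1 := nrm_sq_add u0 y (-1)
      rw [hwy, n0]
      rw [hu0] at n1 ⊢
      nlinarith [sq_nonneg (nrm (u0 + (-1 : ℝ) • y)), nrm_nonneg y]
    · change ε / 2 < |auxB a x w w|
      rw [hwy]; exact hy y hy1
  have hsup : volume {w : Fin d → ℝ | nrm w ^ 2 < 2} ≤ ENNReal.ofReal ((3/2) ^ d) * V := by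
    rw [hV, ← aux_vol 0 (3/2) (by norm_num)]
    apply measure_mono
    intro w hw
    have hw : nrm w ^ 2 < 2 := hw
    change nrm ((3/2 : ℝ)⁻¹ • (w - 0)) < 1
    rw [sub_zero, nrm_smul, abs_of_pos (by norm_num)]
    have : nrm w < 3/2 := by nlinarith [nrm_nonneg w]
    linarith
  have hup : ((sample n d).prod volume) S ≤ p * (ENNReal.ofReal ((3/2) ^ d) * V) := by
    rw [Measure.prod_apply_symm hSm]
    calc ∫⁻ w, sample n d ((fun x => (x, w)) ⁻¹' S)
        ≤ ∫⁻ w, ({w : Fin d → ℝ | nrm w ^ 2 < 2}).indicator (fun _ => p) w := by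
          apply lintegral_mono
          intro w
          by_cases hw : nrm w ^ 2 < 2
          · rw [Set.indicator_of_mem (by exact hw)]
            exact (measure_mono fun x hx => hx.2).trans (hp w hw.le)
          · rw [Set.indicator_of_notMem (by exact hw)]
            have : (fun x => (x, w)) ⁻¹' S = ∅ := by
              apply Set.eq_empty_of_forall_notMem
              intro x hx
              exact hw hx.1
            simp [this]
      _ = p * volume {w : Fin d → ℝ | nrm w ^ 2 < 2} := by
          rw [lintegral_indicator_const]
          exact (isOpen_lt (cont_nrm.pow 2) continuous_const).measurableSet
      _ ≤ _ := by gcongr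
  have hmk : ENNReal.ofReal ((1/8) ^ d) * V * sample n d {x : Fin n → Fin d → ℝ |
      ∃ u v : Fin d → ℝ, nrm u = 1 ∧ nrm v = 1 ∧ ε < |auxB a x u v|} ≤
      ((sample n d).prod volume) S := by
    rw [Measure.prod_apply hSm]
    refine le_trans ?_ (mul_meas_ge_le_lintegral (measurable_measure_prodMk_left hSm)
      (ENNReal.ofReal ((1/8) ^ d) * V))
    exact mul_le_mul_right (measure_mono low) _
  have hc0 : ENNReal.ofReal ((1/8) ^ d) * V ≠ 0 :=
    mul_ne_zero (by simp) (aux_vol_pos d)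
  have hct : ENNReal.ofReal ((1/8) ^ d) * V ≠ ⊤ :=
    ENNReal.mul_ne_top ENNReal.ofReal_ne_top (aux_vol_fin d)
  rw [← ENNReal.mul_le_mul_iff_right hc0 hct]
  refine (hmk.trans hup).trans (le_of_eq ?_)
  have : ((3/2 : ℝ)) ^ d = (1/8)^d * 12^d := by rw [← mul_pow]; norm_num
  rw [this, ENNReal.ofReal_mul (by positivity)]
  ring

/-- **Lemma D.2**: there exist absolute constants `C, c > 0` such that if `a ∈ ℝ^n` satisfies
`‖a‖₂ ≤ C√n` and `‖a‖_∞ ≤ Ct`, and `X_1, …, X_n` are i.i.d. `N(0, I_d)`, then for any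
`ε > 0`, with probability at least `1 - C e^{Cd - cn min(ε², ε/t)}`,
`sup_{u,v ∈ S^{d-1}} |(1/n) Σ_i a_i (u^⊤X_i)(v^⊤X_i) - ((1/n) Σ_i a_i) u^⊤v| ≤ ε`. -/
theorem stmt14 :
    ∃ C > (0 : ℝ), ∃ c > (0 : ℝ),
      ∀ (n d : ℕ) (t : ℝ) (a : Fin n → ℝ) (ε : ℝ),
        0 < t → 0 < ε →
        Real.sqrt (∑ i, (a i) ^ 2) ≤ C * Real.sqrt n → (∀ i, |a i| ≤ C * t) →
        1 - C * Real.exp (C * d - c * n * min (ε ^ 2) (ε / t)) ≤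
          (sample n d {x | ∀ u v : Fin d → ℝ, nrm u = 1 → nrm v = 1 →
              |(1 / n) * ∑ i, a i * (dot u (x i)) * (dot v (x i)) -
                  ((1 / n) * ∑ i, a i) * dot u v| ≤ ε}).toReal := by
  refine ⟨3, by norm_num, 1/1152, by norm_num, ?_⟩
  intro n d t a ε ht hε ha2 hai
  rcases Nat.eq_zero_or_pos n with hn | hn
  · subst hn
    have h1 : (1:ℝ) ≤ rexp (3 * d - 1/1152 * (0:ℕ) * min (ε ^ 2) (ε / t)) := by
      apply Real.one_le_exp
      simp
    refine le_trans ?_ ENNReal.toReal_nonneg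
    linarith
  have hn' : (0:ℝ) < n := by exact_mod_cast hn
  set s := min (ε / 288) (1 / (24 * t)) with hs
  have hs0 : 0 < s := lt_min (by positivity) (by positivity)
  have hs1 : s ≤ ε / 288 := min_le_left _ _
  have hs2 : s * t ≤ 1 / 24 := by
    calc s * t ≤ 1 / (24 * t) * t := by gcongr; exact min_le_right _ _
      _ = 1 / 24 := by field_simp
  have hb : ∀ i, |s * a i| * 2 ≤ 1/4 := by
    intro i
    rw [abs_mul, abs_of_pos hs0]
    nlinarith [hai i]
  have ha2' : ∑ i, a i ^ 2 ≤ 9 * n := by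
    have h0 : 0 ≤ ∑ i, a i ^ 2 := Finset.sum_nonneg fun _ _ => sq_nonneg _
    calc ∑ i, a i ^ 2 = √(∑ i, a i ^ 2) ^ 2 := (Real.sq_sqrt h0).symm
      _ ≤ (3 * √n) ^ 2 := by gcongr
      _ = 9 * n := by rw [mul_pow, Real.sq_sqrt hn'.le]; norm_num
  set m := min (ε ^ 2) (ε / t) with hm
  have hsm : m / 288 ≤ s * ε := by
    rw [hs, min_mul_of_nonneg _ _ hε.le]
    apply le_min
    · have : m ≤ ε ^ 2 := min_le_left _ _
      linarith
    · have h1 : m ≤ ε / t := min_le_right _ _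
      have h2 : 0 < ε / t := by positivity
      have h3 : 1 / (24 * t) * ε = (ε / t) / 24 := by field_simp
      rw [h3]; linarith
  have hexp : 8 * s^2 * ∑ i, a i ^ 2 - s * (n * (ε / 2)) ≤ - (1/1152 * n * m) := by
    have h1 : 8 * s^2 * ∑ i, a i ^ 2 ≤ 8 * s^2 * (9 * n) := by gcongr
    have h2 : s * (s * n) ≤ (ε / 288) * (s * n) := by gcongr
    have h3 : m / 288 * n ≤ s * ε * n := by gcongr
    nlinarith
  have hp : ∀ w : Fin d → ℝ, nrm w ^ 2 ≤ 2 → sample n d {x | ε / 2 < |auxB a x w w|} ≤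
      2 * ENNReal.ofReal (rexp (- (1/1152 * n * m))) := by
    intro w hw
    refine le_trans (measure_mono ?_) ((aux_tail a w hw s hs0 hb (n * (ε / 2))).trans ?_)
    · intro x hx
      rw [Set.mem_ofPred_eq, auxB_diag, abs_mul, abs_of_pos (by positivity)] at hx
      rw [Set.mem_ofPred_eq]
      calc n * (ε / 2) < n * (1 / n * |∑ i, a i * (dot w (x i) ^ 2 - nrm w ^ 2)|) := by gcongr
        _ = _ := by field_simp
    · gcongr
  have hU := aux_union a ε hε _ hp
  set G : Set (Fin n → Fin d → ℝ) := {x | ∀ u v : Fin d → ℝ, nrm u = 1 → nrm v = 1 →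
              |(1 / n) * ∑ i, a i * (dot u (x i)) * (dot v (x i)) -
                  ((1 / n) * ∑ i, a i) * dot u v| ≤ ε} with hG
  have hGc : Gᶜ ⊆ {x | ∃ u v : Fin d → ℝ, nrm u = 1 ∧ nrm v = 1 ∧ ε < |auxB a x u v|} := by
    intro x hx
    simp only [hG, Set.mem_compl_iff, Set.mem_ofPred_eq, not_forall, not_le] at hx
    obtain ⟨u, v, hu, hv, h⟩ := hx
    exact ⟨u, v, hu, hv, h⟩
  have hGm := (measure_mono (μ := sample n d) hGc).trans hU
  have h2 : (2 : ENNReal) = ENNReal.ofReal 2 := by simp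
  rw [h2, ← ENNReal.ofReal_mul (by norm_num), ← ENNReal.ofReal_mul (by positivity)] at hGm
  have hGr : (sample n d Gᶜ).toReal ≤ 2 * rexp (- (1/1152 * n * m)) * 12 ^ d :=
    ENNReal.toReal_le_of_le_ofReal (by positivity) hGm
  have hsum : 1 ≤ (sample n d G).toReal + (sample n d Gᶜ).toReal := by
    rw [← ENNReal.toReal_add (measure_ne_top _ _) (measure_ne_top _ _)]
    have h1 : (1 : ENNReal) ≤ sample n d G + sample n d Gᶜ := by
      rw [← measure_univ (μ := sample n d), ← Set.union_compl_self G]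
      exact measure_union_le _ _
    simpa using ENNReal.toReal_mono
      (ENNReal.add_ne_top.2 ⟨measure_ne_top _ _, measure_ne_top _ _⟩) h1
  have h12 : (12:ℝ) ^ d ≤ rexp (3 * d) := by
    have h1 := Real.exp_one_gt_d9
    have h3 : (12:ℝ) ≤ rexp 3 := by
      have : rexp 3 = rexp 1 ^ 3 := by rw [← Real.exp_nat_mul]; norm_num
      rw [this]
      calc (12:ℝ) ≤ 2.7 ^ 3 := by norm_num
        _ ≤ _ := by gcongr; linarith
    rw [mul_comm, Real.exp_nat_mul]
    gcongr
  have hfin : 2 * rexp (- (1/1152 * n * m)) * 12 ^ d ≤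
      3 * rexp (3 * d - 1/1152 * n * m) := by
    rw [sub_eq_add_neg, Real.exp_add]
    have h1 : rexp (- (1/1152 * n * m)) * 12 ^ d ≤ rexp (- (1/1152 * n * m)) * rexp (3 * d) := by
      gcongr
    have h3 : 0 < rexp (- (1/1152 * n * m)) * rexp (3 * d) := by positivity
    linarith
  linarith
end
end

section
/- Let f: R → R be L-Lipschitz with compact support contained in [−N, N]. Let X and X₁, …, X_n be i.i.d. N(0, I_d) random vectors, and let Y₁, …, Y_n be i.i.d. real random variables with |Y| ≤ t almost surely and E[Y²] ≤ C, independent of (X₁, …, X_n). Then there exist absolute constants C, c > 0 such that for any ε > 0, with probability at least 1 − C e^{C d − c n} − C/n − 2 (1 + 2L/ε)^d exp(−c n ε²/(L² N² t²)), one has sup_{u ∈ S^{d−1}} | (1/n) Σ_{i=1}^n f(u^⊤ X_i) Y_i − E[f(u^⊤ X) Y] | ≤ C ε. -/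
open MeasureTheory ProbabilityTheory Real

noncomputable section

open scoped ENNReal NNReal in
open Metric Module in
open scoped Function in
lemma sep_card {E : Type*} [NormedAddCommGroup E] [NormedSpace ℝ E] [FiniteDimensional ℝ E]
    (s : Finset E) (hs : ∀ c ∈ s, ‖c‖ ≤ 1) {δ : ℝ} (hδ : 0 < δ)
    (h : ∀ c ∈ s, ∀ d ∈ s, c ≠ d → δ ≤ ‖c - d‖) :
    (s.card : ℝ) ≤ (1 + 2 / δ) ^ finrank ℝ E := by
  borelize E
  let μ : Measure E := Measure.addHaar
  let r : ℝ := δ / 2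
  let ρ : ℝ := 1 + δ / 2
  have rpos : 0 < r := by positivity
  have ρpos : 0 < ρ := by positivity
  set A := ⋃ c ∈ s, ball (c : E) r with hA
  have D : Set.Pairwise (s : Set E) (Disjoint on fun c => ball (c : E) r) := by
    rintro c hc d hd hcd
    apply ball_disjoint_ball
    rw [dist_eq_norm]
    have := h c hc d hd hcd
    simp only [r]; linarith
  have A_subset : A ⊆ ball (0 : E) ρ := by
    refine Set.iUnion₂_subset fun x hx => ?_
    apply ball_subset_ball'
    rw [dist_zero_right]
    have := hs x hx
    simp only [r, ρ]; linarith
  have I :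
    (s.card : ℝ≥0∞) * ENNReal.ofReal (r ^ finrank ℝ E) * μ (ball 0 1) ≤
      ENNReal.ofReal (ρ ^ finrank ℝ E) * μ (ball 0 1) :=
    calc
      (s.card : ℝ≥0∞) * ENNReal.ofReal (r ^ finrank ℝ E) * μ (ball 0 1) = μ A := by
        rw [hA, measure_biUnion_finset D fun c _ => measurableSet_ball]
        simp only [μ.addHaar_ball_of_pos _ rpos]
        simp only [Finset.sum_const, nsmul_eq_mul, mul_assoc]
      _ ≤ μ (ball (0 : E) ρ) := measure_mono A_subset
      _ = ENNReal.ofReal (ρ ^ finrank ℝ E) * μ (ball 0 1) := by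
        simp only [μ.addHaar_ball_of_pos _ ρpos]
  have J : (s.card : ℝ≥0∞) * ENNReal.ofReal (r ^ finrank ℝ E) ≤ ENNReal.ofReal (ρ ^ finrank ℝ E) :=
    (ENNReal.mul_le_mul_iff_left (measure_ball_pos _ _ zero_lt_one).ne' measure_ball_lt_top.ne).1 I
  have K := ENNReal.toReal_le_of_le_ofReal (pow_nonneg ρpos.le _) J
  rw [ENNReal.toReal_mul, ENNReal.toReal_natCast, ENNReal.toReal_ofReal (by positivity)] at K
  have e : (1 + 2 / δ) = ρ / r := by simp only [ρ, r]; field_simp; ring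
  rw [e, div_pow, le_div_iff₀ (by positivity)]
  exact K

lemma exists_net_E {E : Type*} [NormedAddCommGroup E] [NormedSpace ℝ E] [FiniteDimensional ℝ E]
    {δ : ℝ} (hδ : 0 < δ) :
    ∃ T : Finset E, (∀ c ∈ T, ‖c‖ = 1) ∧ (∀ u : E, ‖u‖ = 1 → ∃ c ∈ T, ‖u - c‖ ≤ δ) ∧
      (T.card : ℝ) ≤ (1 + 2 / δ) ^ Module.finrank ℝ E := by
  classical
  let P : Finset E → Prop := fun s => (∀ c ∈ s, ‖c‖ = 1) ∧
    ∀ c ∈ s, ∀ d ∈ s, c ≠ d → δ ≤ ‖c - d‖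
  let S : Set ℕ := {k | ∃ s, P s ∧ s.card = k}
  have hb : BddAbove S := by
    refine ⟨⌊(1 + 2 / δ) ^ Module.finrank ℝ E⌋₊, ?_⟩
    rintro k ⟨s, hs, rfl⟩
    exact Nat.le_floor (sep_card s (fun c hc => (hs.1 c hc).le) hδ hs.2)
  have hne : S.Nonempty := ⟨0, ∅, by simp [P], by simp⟩
  obtain ⟨T, hT, hTc⟩ := Nat.sSup_mem hne hb
  refine ⟨T, hT.1, ?_, sep_card T (fun c hc => (hT.1 c hc).le) hδ hT.2⟩
  intro u hu
  by_contra! hcon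
  have hnot : u ∉ T := fun h => by
    have := hcon u h; simp at this; linarith
  have : (insert u T).card ∈ S := by
    refine ⟨insert u T, ⟨?_, ?_⟩, rfl⟩
    · intro c hc
      rcases Finset.mem_insert.1 hc with rfl | hc
      · exact hu
      · exact hT.1 c hc
    · intro c hc d hd hcd
      rcases Finset.mem_insert.1 hc with hcu | hcT <;>
        rcases Finset.mem_insert.1 hd with hdu | hdT
      · exact absurd (hcu.trans hdu.symm) hcd
      · rw [hcu]; exact (hcon d hdT).le
      · rw [hdu, norm_sub_rev]; exact (hcon c hcT).le
      · exact hT.2 c hcT d hdT hcd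
  have h2 := le_csSup hb this
  rw [Finset.card_insert_of_notMem hnot, hTc] at h2
  omega

lemma nrm_eq {d : ℕ} (u : EuclideanSpace ℝ (Fin d)) : nrm (WithLp.ofLp u) = ‖u‖ := by
  simp [nrm, EuclideanSpace.norm_eq]

lemma nrm_eq' {d : ℕ} (u : Fin d → ℝ) : nrm u = ‖WithLp.toLp 2 u‖ := by
  simp [nrm, EuclideanSpace.norm_eq]

lemma dot_eq {d : ℕ} (u v : Fin d → ℝ) :
    dot u v = inner ℝ (WithLp.toLp 2 u) (WithLp.toLp 2 v) := by
  simp [dot, PiLp.inner_apply, mul_comm]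

lemma exists_net (d : ℕ) {δ : ℝ} (hδ : 0 < δ) :
    ∃ T : Finset (Fin d → ℝ), (∀ c ∈ T, nrm c = 1) ∧
      (∀ u : Fin d → ℝ, nrm u = 1 → ∃ c ∈ T, nrm (u - c) ≤ δ) ∧
      (T.card : ℝ) ≤ (1 + 2 / δ) ^ d := by
  classical
  obtain ⟨T, h1, h2, h3⟩ := exists_net_E (E := EuclideanSpace ℝ (Fin d)) hδ
  refine ⟨T.image WithLp.ofLp, ?_, ?_, ?_⟩
  · intro c hc
    obtain ⟨c', hcT, rfl⟩ := Finset.mem_image.1 hc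
    rw [nrm_eq, h1 c' hcT]
  · intro u hu
    obtain ⟨c, hc, huc⟩ := h2 (WithLp.toLp 2 u) (by rw [← nrm_eq', hu])
    refine ⟨WithLp.ofLp c, Finset.mem_image_of_mem _ hc, ?_⟩
    rw [nrm_eq']; simpa using huc
  · rw [finrank_euclideanSpace_fin] at h3
    refine le_trans ?_ h3
    exact_mod_cast Finset.card_image_le

instance (d : ℕ) : IsProbabilityMeasure (_root_.stdGaussian d) := by
  unfold _root_.stdGaussian; infer_instance

lemma measurable_dot {d : ℕ} (w : Fin d → ℝ) : Measurable (dot w) := by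
  unfold dot; fun_prop

lemma map_dot {d : ℕ} (w : Fin d → ℝ) :
    (_root_.stdGaussian d).map (dot w) = gaussianReal 0 (Real.toNNReal (nrm w ^ 2)) := by
  set L : StrongDual ℝ (EuclideanSpace ℝ (Fin d)) := innerSL ℝ (WithLp.toLp 2 w) with hL
  have h := map_pi_eq_stdGaussian (ι := Fin d)
  have h1 : dot w = L ∘ (WithLp.toLp 2) := by
    ext x; simp [hL, dot_eq]
  rw [h1, ← Measure.map_map (by fun_prop) (by fun_prop), _root_.stdGaussian, h,
    IsGaussian.map_eq_gaussianReal, integral_strongDual_stdGaussian, variance_dual_stdGaussian,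
    hL, innerSL_apply_norm, nrm_eq']

lemma gauss_exp : Integrable (fun x : ℝ => Real.exp (x ^ 2 / 4)) (gaussianReal 0 1) ∧
    ∫ x, Real.exp (x ^ 2 / 4) ∂(gaussianReal 0 1) = Real.sqrt 2 := by
  have e : ∀ x : ℝ, gaussianPDFReal 0 1 x * Real.exp (x ^ 2 / 4)
      = (√(2 * π))⁻¹ * Real.exp (-(1/4) * x ^ 2) := by
    intro x
    simp only [gaussianPDFReal, NNReal.coe_one, mul_one, sub_zero]
    rw [mul_assoc, ← Real.exp_add]; congr 2; ring
  constructor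
  · rw [gaussianReal_of_var_ne_zero _ one_ne_zero,
      integrable_withDensity_iff_integrable_smul' (measurable_gaussianPDF 0 1)
      (by simp [gaussianPDF])]
    simp only [toReal_gaussianPDF, smul_eq_mul, e]
    exact (integrable_exp_neg_mul_sq (by norm_num)).const_mul _
  · rw [integral_gaussianReal_eq_integral_smul one_ne_zero]
    simp only [smul_eq_mul, e]
    rw [integral_const_mul, integral_gaussian, inv_mul_eq_div, ← Real.sqrt_div' _ (by positivity)]
    congr 1; field_simp; norm_num

lemma dot_exp {d : ℕ} {w : Fin d → ℝ} (hw : nrm w = 1) :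
    Integrable (fun x => Real.exp (dot w x ^ 2 / 4)) (_root_.stdGaussian d) ∧
    ∫ x, Real.exp (dot w x ^ 2 / 4) ∂(_root_.stdGaussian d) = Real.sqrt 2 := by
  have h := map_dot w
  rw [hw] at h
  simp only [one_pow, Real.toNNReal_one] at h
  obtain ⟨h1, h2⟩ := gauss_exp
  rw [← h] at h1 h2
  rw [integral_map (measurable_dot w).aemeasurable (by fun_prop)] at h2
  exact ⟨h1.comp_measurable (measurable_dot w), h2⟩

lemma dot_sq {d : ℕ} (w : Fin d → ℝ) :
    Integrable (fun x => dot w x ^ 2) (_root_.stdGaussian d) ∧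
    ∫ x, dot w x ^ 2 ∂(_root_.stdGaussian d) = nrm w ^ 2 := by
  have h := map_dot w
  have hi : MemLp id 2 ((_root_.stdGaussian d).map (dot w)) := by
    rw [h]; exact memLp_id_gaussianReal 2
  have hi2 : MemLp (dot w) 2 (_root_.stdGaussian d) :=
    (memLp_map_measure_iff (by fun_prop) (measurable_dot w).aemeasurable).1 hi
  refine ⟨hi2.integrable_sq, ?_⟩
  have hm : ∫ x, dot w x ∂(_root_.stdGaussian d) = 0 := by
    have := integral_id_gaussianReal (μ := 0) (v := Real.toNNReal (nrm w ^ 2))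
    rw [← h, integral_map (measurable_dot w).aemeasurable (by fun_prop)] at this
    simpa using this
  have hv := variance_id_gaussianReal (μ := 0) (v := Real.toNNReal (nrm w ^ 2))
  rw [← h, variance_map (by fun_prop) (measurable_dot w).aemeasurable] at hv
  rw [variance_of_integral_eq_zero (by exact (measurable_dot w).aemeasurable) (by simpa using hm)] at hv
  rw [Real.coe_toNNReal _ (by positivity)] at hv
  simpa using hv

lemma chernoff {Ω : Type*} [MeasurableSpace Ω] (ρ : Measure Ω) [IsProbabilityMeasure ρ] (n : ℕ)
    (h : Ω → ℝ) (hi : Integrable (fun x => Real.exp (h x)) ρ) (a : ℝ) :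
    (Measure.pi (fun _ : Fin n => ρ)).real {ω | a ≤ ∑ i, h (ω i)} ≤
      Real.exp (-a) * (∫ x, Real.exp (h x) ∂ρ) ^ n := by
  have h1 : Integrable (fun ω : Fin n → Ω => ∏ i, Real.exp (h (ω i))) (Measure.pi fun _ => ρ) :=
    Integrable.fintype_prod (f := fun _ x => Real.exp (h x)) (fun _ => hi)
  have h2 := mul_meas_ge_le_integral_of_nonneg (μ := Measure.pi (fun _ : Fin n => ρ))
    (f := fun ω : Fin n → Ω => ∏ i, Real.exp (h (ω i)))
    (Filter.Eventually.of_forall fun ω => by positivity) h1 (Real.exp a)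
  rw [integral_fintype_prod_eq_pow (fun x => Real.exp (h x)), Fintype.card_fin] at h2
  simp only [← Real.exp_sum, Real.exp_le_exp] at h2
  rw [Real.exp_neg, inv_mul_eq_div, le_div_iff₀' (Real.exp_pos a)]
  exact h2

lemma integral_abs_le {Ω : Type*} [MeasurableSpace Ω] (ρ : Measure Ω) [IsProbabilityMeasure ρ]
    {g : Ω → ℝ} (hg : MemLp g 2 ρ) {K : ℝ} (hK : 0 ≤ K) (h : ∫ x, g x ^ 2 ∂ρ ≤ K ^ 2) :
    ∫ x, |g x| ∂ρ ≤ K := by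
  have h1 := variance_nonneg (fun x => |g x|) ρ
  have h2 : MemLp (fun x => |g x|) 2 ρ := hg.abs
  rw [variance_eq_sub h2] at h1
  simp only [Pi.pow_apply, sq_abs] at h1
  exact abs_le_of_sq_le_sq' (by linarith) hK |>.2

lemma hoeff {Ω : Type*} [MeasurableSpace Ω] (ρ : Measure Ω) [IsProbabilityMeasure ρ] (n : ℕ)
    (h : Ω → ℝ) (hm : AEMeasurable h ρ) {b a : ℝ} (hb : 0 < b) (ha : 0 < a)
    (hbd : ∀ᵐ x ∂ρ, |h x| ≤ b) :
    (Measure.pi (fun _ : Fin n => ρ)).real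
        {ω | n * a ≤ |∑ i, h (ω i) - n * ∫ x, h x ∂ρ|} ≤
      2 * Real.exp (- (n * a ^ 2 / (2 * b ^ 2))) := by
  have hs := hasSubgaussianMGF_of_mem_Icc (a := -b) (b := b) hm
    (by filter_upwards [hbd] with x hx using abs_le.1 hx)
  have hc : (((‖b - -b‖₊ / 2) ^ 2 : NNReal) : ℝ) = b ^ 2 := by
    push_cast
    rw [Real.norm_eq_abs, abs_of_pos (by linarith)]
    ring
  set m := ∫ x, h x ∂ρ with hmdef
  have key : ∀ s : ℝ, s ^ 2 = (a / b ^ 2) ^ 2 →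
      (Measure.pi (fun _ : Fin n => ρ)).real
        {ω | n * (a * (a / b ^ 2)) ≤ ∑ i, s * (h (ω i) - m)} ≤
      Real.exp (- (n * a ^ 2 / (2 * b ^ 2))) := by
    intro s hs2
    refine (chernoff ρ n (fun x => s * (h x - m)) (hs.integrable_exp_mul s) _).trans ?_
    have h1 := hs.mgf_le s
    rw [hc, hs2, mgf] at h1
    calc _ ≤ Real.exp (-(n * (a * (a / b ^ 2)))) *
          (Real.exp (b ^ 2 * (a / b ^ 2) ^ 2 / 2)) ^ n := by
          gcongr
      _ = _ := by
          rw [← Real.exp_nat_mul, ← Real.exp_add]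
          congr 1; field_simp; ring
  have k1 := key (a / b ^ 2) rfl
  have k2 := key (-(a / b ^ 2)) (by ring)
  have hsub : {ω : Fin n → Ω | n * a ≤ |∑ i, h (ω i) - n * m|} ⊆
      {ω | n * (a * (a / b ^ 2)) ≤ ∑ i, (a / b ^ 2) * (h (ω i) - m)} ∪
      {ω | n * (a * (a / b ^ 2)) ≤ ∑ i, (-(a / b ^ 2)) * (h (ω i) - m)} := by
    intro ω hω
    simp only [Set.mem_ofPred_eq, Set.mem_union, ← Finset.mul_sum, Finset.sum_sub_distrib,
      Finset.sum_const, Finset.card_univ, Fintype.card_fin, nsmul_eq_mul] at hω ⊢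
    have hp : 0 < a / b ^ 2 := by positivity
    rcases le_abs.1 hω with h1 | h1
    · left; nlinarith
    · right; nlinarith
  calc _ ≤ _ := measureReal_mono hsub
    _ ≤ _ := measureReal_union_le _ _
    _ ≤ _ := by linarith

lemma ysq {Ω : Type*} [MeasurableSpace Ω] (ρ : Measure Ω) [IsProbabilityMeasure ρ] (n : ℕ)
    (g : Ω → ℝ) (hm : AEMeasurable g ρ) {t C : ℝ} (ht : 0 < t)
    (hbd : ∀ᵐ x ∂ρ, |g x| ≤ t) (h2 : ∫ x, g x ^ 2 ∂ρ ≤ C) :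
    (Measure.pi (fun _ : Fin n => ρ)).real {ω | 4 * C * n ≤ ∑ i, g (ω i) ^ 2} ≤
      Real.exp (- (2 * C * n / t ^ 2)) := by
  have hbd2 : ∀ᵐ x ∂ρ, g x ^ 2 / t ^ 2 ∈ Set.Icc 0 1 := by
    filter_upwards [hbd] with x hx
    refine ⟨by positivity, ?_⟩
    rw [div_le_one (by positivity), ← sq_abs]
    gcongr
  have i1 : Integrable (fun x => g x ^ 2 / t ^ 2) ρ :=
    Integrable.of_mem_Icc 0 1 (by fun_prop) hbd2
  have hi : Integrable (fun x => Real.exp (g x ^ 2 / t ^ 2)) ρ := by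
    refine Integrable.of_mem_Icc 0 (Real.exp 1) (by fun_prop) ?_
    filter_upwards [hbd2] with x hx
    exact ⟨by positivity, Real.exp_le_exp.2 hx.2⟩
  have hE : ∫ x, Real.exp (g x ^ 2 / t ^ 2) ∂ρ ≤ Real.exp (2 * C / t ^ 2) := by
    calc _ ≤ ∫ x, (1 + 2 * (g x ^ 2 / t ^ 2)) ∂ρ := by
          refine integral_mono_ae hi ((integrable_const _).add (i1.const_mul 2)) ?_
          filter_upwards [hbd2] with x hx
          have h3 := Real.abs_exp_sub_one_le (x := g x ^ 2 / t ^ 2)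
            (by rw [abs_of_nonneg hx.1]; exact hx.2)
          rw [abs_of_nonneg hx.1] at h3
          have := (abs_le.1 h3).2
          linarith
      _ = 1 + 2 * ((∫ x, g x ^ 2 ∂ρ) / t ^ 2) := by
          rw [integral_add (integrable_const _) (i1.const_mul 2), integral_const_mul, integral_div]
          simp
      _ ≤ 1 + 2 * C / t ^ 2 := by
          rw [mul_div_assoc]; gcongr
      _ ≤ _ := by linarith [Real.add_one_le_exp (2 * C / t ^ 2)]
  have h3 := chernoff ρ n (fun x => g x ^ 2 / t ^ 2) hi (4 * C * n / t ^ 2)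
  simp only [← Finset.sum_div] at h3
  have e : ∀ ω : Fin n → Ω, 4 * C * n / t ^ 2 ≤ (∑ i, g (ω i) ^ 2) / t ^ 2 ↔
      4 * C * n ≤ ∑ i, g (ω i) ^ 2 := fun ω => div_le_div_iff_of_pos_right (by positivity)
  simp only [e] at h3
  refine h3.trans ?_
  calc _ ≤ Real.exp (-(4 * C * n / t ^ 2)) * Real.exp (2 * C / t ^ 2) ^ n := by
        gcongr
    _ = _ := by
        rw [← Real.exp_nat_mul, ← Real.exp_add]
        congr 1; ring

lemma cheb {Ω : Type*} [MeasurableSpace Ω] (ρ : Measure Ω) [IsProbabilityMeasure ρ] (n : ℕ)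
    (hn : 0 < n) (g : Ω → ℝ) (hg : MemLp g 2 ρ) (h2 : ∫ x, g x ^ 2 ∂ρ ≤ 100) :
    (Measure.pi (fun _ : Fin n => ρ)).real {ω | 20 * n ≤ ∑ i, |g (ω i)|} ≤ 100 / n := by
  have hn' : (0 : ℝ) < n := by exact_mod_cast hn
  have hga : MemLp (fun x => |g x|) 2 ρ := hg.abs
  have hm : ∫ x, |g x| ∂ρ ≤ 10 := integral_abs_le ρ hg (by norm_num) (by linarith)
  have hv : Var[fun x => |g x|; ρ] ≤ 100 := by
    refine (variance_le_expectation_sq hga.aestronglyMeasurable).trans ?_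
    simpa using h2
  have hsum := variance_sum_pi (μ := fun _ : Fin n => ρ) (X := fun _ x => |g x|) (fun _ => hga)
  simp only [Finset.sum_const, Finset.card_univ, Fintype.card_fin, nsmul_eq_mul] at hsum
  have hml : MemLp (∑ i : Fin n, fun ω : Fin n → Ω => |g (ω i)|) 2 (Measure.pi fun _ => ρ) :=
    memLp_finsetSum' _ fun i _ => hga.comp_measurePreserving (measurePreserving_eval _ i)
  have hE : ∫ ω, (∑ i : Fin n, fun ω : Fin n → Ω => |g (ω i)|) ω ∂(Measure.pi fun _ => ρ)
      = n * ∫ x, |g x| ∂ρ := by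
    simp only [Finset.sum_apply]
    rw [integral_finsetSum]
    · have : ∀ i : Fin n, ∫ ω : Fin n → Ω, |g (ω i)| ∂(Measure.pi fun _ => ρ) = ∫ x, |g x| ∂ρ := by
        intro i
        exact integral_comp_eval (μ := fun _ : Fin n => ρ) (f := fun x => |g x|)
          hga.aestronglyMeasurable
      simp [this]
    · intro i _
      exact (hga.comp_measurePreserving (measurePreserving_eval (fun _ : Fin n => ρ) i)).integrable
        (by norm_num)
  have hc := meas_ge_le_variance_div_sq hml (c := 10 * n) (by positivity)
  rw [hE, hsum] at hc
  have hsub : {ω : Fin n → Ω | 20 * n ≤ ∑ i, |g (ω i)|} ⊆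
      {ω | 10 * n ≤ |(∑ i : Fin n, fun ω : Fin n → Ω => |g (ω i)|) ω - n * ∫ x, |g x| ∂ρ|} := by
    intro ω hω
    simp only [Set.mem_ofPred_eq, Finset.sum_apply] at hω ⊢
    refine le_trans ?_ (le_abs_self _)
    nlinarith
  have hc2 := ENNReal.toReal_le_of_le_ofReal
    (div_nonneg (mul_nonneg hn'.le (variance_nonneg _ _)) (by positivity)) ((measure_mono hsub).trans hc)
  refine hc2.trans ?_
  rw [div_le_div_iff₀ (by positivity) hn']
  nlinarith [variance_nonneg (fun x => |g x|) ρ, mul_pos hn' hn']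

lemma dot_sub_left {d : ℕ} (u v x : Fin d → ℝ) : dot (u - v) x = dot u x - dot v x := by
  simp [dot, sub_mul, Finset.sum_sub_distrib]

lemma opnorm_det {n d : ℕ} (X : Fin n → Fin d → ℝ) (T : Finset (Fin d → ℝ))
    (hT : ∀ u : Fin d → ℝ, nrm u = 1 → ∃ c ∈ T, nrm (u - c) ≤ 1 / 2)
    (hb : ∀ v ∈ T, ∑ i, dot v (X i) ^ 2 ≤ 4 * n) (u : Fin d → ℝ) :
    ∑ i, dot u (X i) ^ 2 ≤ 16 * n * nrm u ^ 2 := by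
  let A₀ : EuclideanSpace ℝ (Fin d) →ₗ[ℝ] EuclideanSpace ℝ (Fin n) :=
    { toFun := fun u => WithLp.toLp 2 fun i => dot (WithLp.ofLp u) (X i)
      map_add' := by
        intro a b; ext i; simp [dot, add_mul, Finset.sum_add_distrib]
      map_smul' := by
        intro a b; ext i; simp [dot, Finset.mul_sum, mul_assoc] }
  let A := LinearMap.toContinuousLinearMap A₀
  have hA : ∀ u : Fin d → ℝ, ‖A (WithLp.toLp 2 u)‖ ^ 2 = ∑ i, dot u (X i) ^ 2 := by
    intro u
    rw [EuclideanSpace.norm_sq_eq]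
    simp [A, A₀]
  have hs : (2 * √n) ^ 2 = 4 * n := by rw [mul_pow, Real.sq_sqrt (by positivity)]; norm_num
  have hle : ‖A‖ ≤ 2 * √n + ‖A‖ / 2 := by
    refine ContinuousLinearMap.opNorm_le_of_unit_norm (by positivity) ?_
    intro x hx
    obtain ⟨c, hc, hxc⟩ := hT (WithLp.ofLp x) (by rw [nrm_eq, hx])
    have h1 : ‖A (WithLp.toLp 2 c)‖ ≤ 2 * √n := by
      refine abs_le_of_sq_le_sq' ?_ (by positivity) |>.2
      rw [hA, hs]; exact hb c hc
    have h2 : ‖A (x - WithLp.toLp 2 c)‖ ≤ ‖A‖ * (1 / 2) := by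
      refine (A.le_opNorm _).trans ?_
      gcongr
      rw [nrm_eq'] at hxc; simpa using hxc
    have h3 : A x = A (WithLp.toLp 2 c) + A (x - WithLp.toLp 2 c) := by simp
    rw [h3]
    refine (norm_add_le _ _).trans ?_
    linarith
  have hle2 : ‖A‖ ≤ 4 * √n := by linarith
  rw [← hA, nrm_eq']
  have := (A.le_opNorm (WithLp.toLp 2 u)).trans (mul_le_mul_of_nonneg_right hle2 (norm_nonneg _))
  calc _ ≤ (4 * √n * ‖WithLp.toLp 2 u‖) ^ 2 := by gcongr
    _ = _ := by rw [mul_pow, mul_pow, Real.sq_sqrt (by positivity)]; norm_num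

lemma lip_det {n d : ℕ} (X : Fin n → Fin d → ℝ) (y : Fin n → ℝ) {L : ℝ} (hL : 0 < L) {f : ℝ → ℝ}
    (hf : ∀ x y : ℝ, |f x - f y| ≤ L * |x - y|)
    (hX : ∀ u : Fin d → ℝ, ∑ i, dot u (X i) ^ 2 ≤ 16 * n * nrm u ^ 2)
    (hy : ∑ i, y i ^ 2 ≤ 400 * n) (u v : Fin d → ℝ) :
    |∑ i, f (dot u (X i)) * y i - ∑ i, f (dot v (X i)) * y i| ≤ 80 * n * L * nrm (u - v) := by
  have hnn : 0 ≤ nrm (u - v) := Real.sqrt_nonneg _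
  have h1 : |∑ i, f (dot u (X i)) * y i - ∑ i, f (dot v (X i)) * y i| ≤
      L * ∑ i, |dot (u - v) (X i)| * |y i| := by
    rw [← Finset.sum_sub_distrib, Finset.mul_sum]
    refine (Finset.abs_sum_le_sum_abs _ _).trans (Finset.sum_le_sum fun i _ => ?_)
    rw [← sub_mul, abs_mul, dot_sub_left, ← mul_assoc]
    gcongr
    exact hf _ _
  have h2 : ∑ i, |dot (u - v) (X i)| * |y i| ≤ 80 * n * nrm (u - v) := by
    have hcs := Finset.sum_mul_sq_le_sq_mul_sq Finset.univ
      (fun i => |dot (u - v) (X i)|) (fun i => |y i|)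
    simp only [sq_abs] at hcs
    refine abs_le_of_sq_le_sq' (hcs.trans ?_) (by positivity) |>.2
    calc _ ≤ (16 * n * nrm (u - v) ^ 2) * (400 * n) := by
          gcongr
          exact hX _
      _ = _ := by ring
  nlinarith

lemma f_bound {L N : ℝ} (hL : 0 < L) (hN : 0 < N) {f : ℝ → ℝ}
    (hf : ∀ x y : ℝ, |f x - f y| ≤ L * |x - y|) (h0 : ∀ x : ℝ, N < |x| → f x = 0) (x : ℝ) :
    |f x| ≤ L * N := by
  refine le_of_forall_pos_le_add fun η hη => ?_
  by_cases hx : N < |x|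
  · rw [h0 x hx, abs_zero]; positivity
  have hxN := abs_le.1 (not_lt.1 hx)
  have hq : 0 < η / L := by positivity
  have hqe : L * (N + η / L) = L * N + η := by field_simp
  rcases le_total 0 x with h | h
  · have h1 := hf x (N + η / L)
    rw [h0 (N + η / L) (by rw [abs_of_pos (by positivity)]; linarith), sub_zero,
      abs_of_nonpos (a := x - _) (by linarith)] at h1
    nlinarith
  · have h1 := hf x (-(N + η / L))
    rw [h0 (-(N + η / L)) (by rw [abs_neg, abs_of_pos (by positivity)]; linarith), sub_zero,
      abs_of_nonneg (a := x - _) (by linarith)] at h1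
    nlinarith

lemma f_cont {L : ℝ} (hL : 0 < L) {f : ℝ → ℝ}
    (hf : ∀ x y : ℝ, |f x - f y| ≤ L * |x - y|) : Continuous f := by
  have : LipschitzWith L.toNNReal f := LipschitzWith.of_dist_le_mul fun x y => by
    rw [Real.dist_eq, Real.dist_eq, Real.coe_toNNReal _ hL.le]; exact hf x y
  exact this.continuous

lemma lip_exp {d : ℕ} (ν : Measure ℝ) [IsProbabilityMeasure ν] {L N t : ℝ}
    (hL : 0 < L) (hN : 0 < N) {f : ℝ → ℝ}
    (hf : ∀ x y : ℝ, |f x - f y| ≤ L * |x - y|) (h0 : ∀ x : ℝ, N < |x| → f x = 0)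
    (ht : ∀ᵐ y ∂ν, |y| ≤ t) (h2 : ∫ y, y ^ 2 ∂ν ≤ 100) (u v : Fin d → ℝ) :
    |∫ q, f (dot u q.1) * q.2 ∂((_root_.stdGaussian d).prod ν) -
      ∫ q, f (dot v q.1) * q.2 ∂((_root_.stdGaussian d).prod ν)| ≤ 10 * L * nrm (u - v) := by
  have hnn : 0 ≤ nrm (u - v) := Real.sqrt_nonneg _
  have hc := f_cont hL hf
  have hy : MemLp (fun y : ℝ => y) 2 ν :=
    MemLp.of_bound (by fun_prop) t (by simpa using ht)
  have hyi : Integrable (fun y : ℝ => y) ν := hy.integrable (by norm_num)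
  have hw : ∀ w : Fin d → ℝ, Integrable (fun q : (Fin d → ℝ) × ℝ => f (dot w q.1) * q.2)
      ((_root_.stdGaussian d).prod ν) := by
    intro w
    refine Integrable.mul_prod (f := fun x => f (dot w x)) (g := fun y => y) ?_ hyi
    have hmeas : Measurable fun x => f (dot w x) := hc.measurable.comp (measurable_dot w)
    exact Integrable.of_bound hmeas.aestronglyMeasurable (L * N)
      (Filter.Eventually.of_forall fun x => f_bound hL hN hf h0 _)
  obtain ⟨hd1, hd2⟩ := dot_sq (u - v)
  have hd : MemLp (dot (u - v)) 2 (_root_.stdGaussian d) :=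
    (memLp_two_iff_integrable_sq (measurable_dot _).aestronglyMeasurable).2 hd1
  have hE1 : ∫ x, |dot (u - v) x| ∂(_root_.stdGaussian d) ≤ nrm (u - v) :=
    integral_abs_le _ hd hnn hd2.le
  have hE2 : ∫ y, |y| ∂ν ≤ 10 := integral_abs_le _ hy (by norm_num) (by linarith)
  rw [← integral_sub (hw u) (hw v)]
  have hint : Integrable (fun q : (Fin d → ℝ) × ℝ => |dot (u - v) q.1| * |q.2|)
      ((_root_.stdGaussian d).prod ν) :=
    Integrable.mul_prod (f := fun x => |dot (u - v) x|) (g := fun y => |y|)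
      (hd.integrable (by norm_num)).abs hyi.abs
  calc _ ≤ ∫ q, L * (|dot (u - v) q.1| * |q.2|) ∂((_root_.stdGaussian d).prod ν) := by
        refine (abs_integral_le_integral_abs).trans ?_
        refine integral_mono ((hw u).sub (hw v)).abs (hint.const_mul L) fun q => ?_
        simp only
        rw [← sub_mul, abs_mul, dot_sub_left, ← mul_assoc]
        gcongr
        exact hf _ _
    _ = L * ((∫ x, |dot (u - v) x| ∂(_root_.stdGaussian d)) * ∫ y, |y| ∂ν) := by
        rw [integral_const_mul,
          integral_prod_mul (fun x => |dot (u - v) x|) (fun y : ℝ => |y|)]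
    _ ≤ L * (nrm (u - v) * 10) := by
        gcongr
    _ = _ := by ring

/-- The good event on the product of pairs. -/
def goodSet (n d : ℕ) (f : ℝ → ℝ) (ν : Measure ℝ) (ε : ℝ) : Set (Fin n → (Fin d → ℝ) × ℝ) :=
  {ω | ∀ u : Fin d → ℝ, nrm u = 1 →
    |(1 / n) * ∑ i, f (dot u (ω i).1) * (ω i).2 -
      ∫ q, f (dot u q.1) * q.2 ∂((_root_.stdGaussian d).prod ν)| ≤ 100 * ε}

lemma snd_facts {d : ℕ} (ν : Measure ℝ) [IsProbabilityMeasure ν] {t : ℝ}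
    (ht : ∀ᵐ y ∂ν, |y| ≤ t) :
    (∀ᵐ q ∂((_root_.stdGaussian d).prod ν), |q.2| ≤ t) ∧
    (∫ q, q.2 ^ 2 ∂((_root_.stdGaussian d).prod ν) = ∫ y, y ^ 2 ∂ν) ∧
    MemLp (fun q : (Fin d → ℝ) × ℝ => q.2) 2 ((_root_.stdGaussian d).prod ν) := by
  have h1 : ∀ᵐ q ∂((_root_.stdGaussian d).prod ν), |q.2| ≤ t :=
    Measure.quasiMeasurePreserving_snd.ae ht
  refine ⟨h1, ?_, MemLp.of_bound (by fun_prop) t (by simpa using h1)⟩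
  have := integral_fun_snd (μ := _root_.stdGaussian d) (ν := ν) (fun y : ℝ => y ^ 2)
  simpa using this

lemma case_large (n d : ℕ) (hn : 0 < n) (ν : Measure ℝ) [IsProbabilityMeasure ν] {L N t : ℝ}
    (hL : 0 < L) (hN : 0 < N) {f : ℝ → ℝ}
    (hf : ∀ x y : ℝ, |f x - f y| ≤ L * |x - y|) (h0 : ∀ x : ℝ, N < |x| → f x = 0)
    (ht : ∀ᵐ y ∂ν, |y| ≤ t) (h2 : ∫ y, y ^ 2 ∂ν ≤ 100) {ε : ℝ} (hε : L * N ≤ ε) :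
    1 - 100 / n ≤ (Measure.pi fun _ : Fin n => (_root_.stdGaussian d).prod ν).real
      (goodSet n d f ν ε) := by
  have hn' : (0 : ℝ) < n := by exact_mod_cast hn
  have hLN : 0 < L * N := by positivity
  obtain ⟨s1, s2, s3⟩ := snd_facts (d := d) ν ht
  set ρ := (_root_.stdGaussian d).prod ν with hρ
  set Q := Measure.pi fun _ : Fin n => ρ with hQ
  have hc := cheb ρ n hn (fun q => q.2) s3 (by rw [s2]; exact h2)
  have hE : ∫ q, |q.2| ∂ρ ≤ 10 := integral_abs_le ρ s3 (by norm_num) (by rw [s2]; linarith)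
  have hcov : (Set.univ : Set (Fin n → (Fin d → ℝ) × ℝ)) ⊆
      goodSet n d f ν ε ∪ {ω | 20 * n ≤ ∑ i, |(ω i).2|} := by
    intro ω _
    by_cases hω : 20 * n ≤ ∑ i, |(ω i).2|
    · exact Or.inr hω
    left
    intro u hu
    have a1 : |(1 / n : ℝ) * ∑ i, f (dot u (ω i).1) * (ω i).2| ≤ 20 * (L * N) := by
      rw [abs_mul, abs_of_pos (by positivity), one_div, inv_mul_le_iff₀ hn']
      calc _ ≤ ∑ i, |f (dot u (ω i).1) * (ω i).2| := Finset.abs_sum_le_sum_abs _ _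
        _ ≤ ∑ i, (L * N) * |(ω i).2| := by
            refine Finset.sum_le_sum fun i _ => ?_
            rw [abs_mul]; gcongr; exact f_bound hL hN hf h0 _
        _ = (L * N) * ∑ i, |(ω i).2| := by rw [Finset.mul_sum]
        _ ≤ (L * N) * (20 * n) := by gcongr; exact (not_le.1 hω).le
        _ = _ := by ring
    have a2 : |∫ q, f (dot u q.1) * q.2 ∂ρ| ≤ 10 * (L * N) := by
      calc _ ≤ ∫ q, (L * N) * |q.2| ∂ρ := by
            refine norm_integral_le_of_norm_le (f := fun q => f (dot u q.1) * q.2)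
              ((s3.integrable (by norm_num)).abs.const_mul _)
              (Filter.Eventually.of_forall fun q => ?_)
            rw [Real.norm_eq_abs, abs_mul]; gcongr; exact f_bound hL hN hf h0 _
        _ = (L * N) * ∫ q, |q.2| ∂ρ := integral_const_mul _ _
        _ ≤ (L * N) * 10 := by gcongr
        _ = _ := by ring
    refine (abs_sub _ _).trans ?_
    linarith
  have h3 : (1 : ℝ) ≤ Q.real (goodSet n d f ν ε) + 100 / n := by
    calc (1 : ℝ) = Q.real Set.univ := by simp
      _ ≤ _ := measureReal_mono hcov
      _ ≤ _ := measureReal_union_le _ _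
      _ ≤ _ := by gcongr
  linarith

lemma opnorm_prob (n d : ℕ) (ν : Measure ℝ) [IsProbabilityMeasure ν] {v : Fin d → ℝ}
    (hv : nrm v = 1) :
    (Measure.pi fun _ : Fin n => (_root_.stdGaussian d).prod ν).real
      {ω | 4 * n ≤ ∑ i, dot v (ω i).1 ^ 2} ≤ Real.exp (-(n / 2)) := by
  obtain ⟨e1, e2⟩ := dot_exp hv
  have i1 : Integrable (fun q : (Fin d → ℝ) × ℝ => Real.exp (dot v q.1 ^ 2 / 4))
      ((_root_.stdGaussian d).prod ν) := e1.comp_fst ν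
  have h := chernoff ((_root_.stdGaussian d).prod ν) n (fun q => dot v q.1 ^ 2 / 4) i1 n
  have e3 := integral_fun_fst (μ := _root_.stdGaussian d) (ν := ν)
    (fun x => Real.exp (dot v x ^ 2 / 4))
  simp only [probReal_univ, one_smul] at e3
  rw [e3, e2] at h
  simp only [← Finset.sum_div, le_div_iff₀ (show (0 : ℝ) < 4 by norm_num)] at h
  simp only [mul_comm (n : ℝ) 4] at h
  refine h.trans ?_
  have : √2 ≤ Real.exp (1 / 2) := by
    rw [Real.sqrt_le_left (by positivity), ← Real.exp_nat_mul]
    have := Real.add_one_le_exp (1 : ℝ)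
    norm_num at this ⊢
    exact this
  calc _ ≤ Real.exp (-n) * Real.exp (1 / 2) ^ n := by gcongr
    _ = _ := by rw [← Real.exp_nat_mul, ← Real.exp_add]; congr 1; ring

lemma case_small (n d : ℕ) (hn : 0 < n) (ν : Measure ℝ) [IsProbabilityMeasure ν] {L N t : ℝ}
    (hL : 0 < L) (hN : 0 < N) (ht0 : 0 < t) {f : ℝ → ℝ}
    (hf : ∀ x y : ℝ, |f x - f y| ≤ L * |x - y|) (h0 : ∀ x : ℝ, N < |x| → f x = 0)
    (ht : ∀ᵐ y ∂ν, |y| ≤ t) (h2 : ∫ y, y ^ 2 ∂ν ≤ 100) {ε : ℝ} (hε : 0 < ε) :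
    1 - 5 ^ d * Real.exp (-(n / 2)) - Real.exp (-(200 * n / t ^ 2)) -
      (1 + 2 * L / ε) ^ d * (2 * Real.exp (-(n * ε ^ 2 / (2 * (L * N * t) ^ 2)))) ≤
      (Measure.pi fun _ : Fin n => (_root_.stdGaussian d).prod ν).real
      (goodSet n d f ν ε) := by
  have hn' : (0 : ℝ) < n := by exact_mod_cast hn
  obtain ⟨s1, s2, s3⟩ := snd_facts (d := d) ν ht
  obtain ⟨T, T1, T2, T3⟩ := exists_net d (δ := 1 / 2) (by norm_num)
  obtain ⟨S, S1, S2, S3⟩ := exists_net d (δ := ε / L) (by positivity)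
  set ρ := (_root_.stdGaussian d).prod ν with hρ
  set Q := Measure.pi fun _ : Fin n => ρ with hQ
  have hY := ysq ρ n (fun q => q.2) (by fun_prop) ht0 s1 (C := 100) (by rw [s2]; exact h2)
  have hcont := f_cont hL hf
  have hH : ∀ v : Fin d → ℝ, Q.real {ω | n * ε ≤ |∑ i, f (dot v (ω i).1) * (ω i).2 -
      n * ∫ q, f (dot v q.1) * q.2 ∂ρ|} ≤ 2 * Real.exp (-(n * ε ^ 2 / (2 * (L * N * t) ^ 2))) := by
    intro v
    have hmeas : Measurable fun q : (Fin d → ℝ) × ℝ => f (dot v q.1) :=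
      hcont.measurable.comp ((measurable_dot v).comp measurable_fst)
    refine hoeff ρ n (fun q => f (dot v q.1) * q.2) (hmeas.mul measurable_snd).aemeasurable
      (by positivity) hε ?_
    filter_upwards [s1] with q hq
    rw [abs_mul]
    gcongr
    exact f_bound hL hN hf h0 _
  set B1 : Set (Fin n → (Fin d → ℝ) × ℝ) := ⋃ v ∈ T, {ω | 4 * n ≤ ∑ i, dot v (ω i).1 ^ 2} with hB1
  set B2 : Set (Fin n → (Fin d → ℝ) × ℝ) := {ω | 4 * 100 * n ≤ ∑ i, (ω i).2 ^ 2} with hB2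
  set B3 : Set (Fin n → (Fin d → ℝ) × ℝ) := ⋃ v ∈ S, {ω | n * ε ≤
    |∑ i, f (dot v (ω i).1) * (ω i).2 - n * ∫ q, f (dot v q.1) * q.2 ∂ρ|} with hB3
  have b1 : Q.real B1 ≤ 5 ^ d * Real.exp (-(n / 2)) := by
    calc _ ≤ ∑ v ∈ T, Q.real {ω | 4 * n ≤ ∑ i, dot v (ω i).1 ^ 2} :=
          measureReal_biUnion_finset_le _ _
      _ ≤ ∑ v ∈ T, Real.exp (-(n / 2)) :=
          Finset.sum_le_sum fun v hv => opnorm_prob n d ν (T1 v hv)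
      _ = T.card * Real.exp (-(n / 2)) := by simp
      _ ≤ _ := by
          gcongr
          refine T3.trans (le_of_eq ?_)
          norm_num
  have b3 : Q.real B3 ≤ (1 + 2 * L / ε) ^ d *
      (2 * Real.exp (-(n * ε ^ 2 / (2 * (L * N * t) ^ 2)))) := by
    calc _ ≤ ∑ v ∈ S, Q.real {ω | n * ε ≤
          |∑ i, f (dot v (ω i).1) * (ω i).2 - n * ∫ q, f (dot v q.1) * q.2 ∂ρ|} :=
          measureReal_biUnion_finset_le _ _
      _ ≤ ∑ v ∈ S, (2 * Real.exp (-(n * ε ^ 2 / (2 * (L * N * t) ^ 2)))) :=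
          Finset.sum_le_sum fun v hv => hH v
      _ = S.card * (2 * Real.exp (-(n * ε ^ 2 / (2 * (L * N * t) ^ 2)))) := by
          rw [Finset.sum_const, nsmul_eq_mul]
      _ ≤ _ := by
          gcongr
          refine S3.trans (le_of_eq ?_)
          congr 2
          field_simp
  have b2 : Q.real B2 ≤ Real.exp (-(200 * n / t ^ 2)) := by
    refine hY.trans (le_of_eq ?_)
    norm_num
  have hcov : (Set.univ : Set (Fin n → (Fin d → ℝ) × ℝ)) ⊆
      goodSet n d f ν ε ∪ B1 ∪ B2 ∪ B3 := by
    intro ω _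
    by_cases c1 : ω ∈ B1
    · exact Or.inl (Or.inl (Or.inr c1))
    by_cases c2 : ω ∈ B2
    · exact Or.inl (Or.inr c2)
    by_cases c3 : ω ∈ B3
    · exact Or.inr c3
    refine Or.inl (Or.inl (Or.inl ?_))
    simp only [hB1, hB2, hB3, Set.mem_iUnion, Set.mem_ofPred_eq, not_exists, not_le] at c1 c2 c3
    intro u hu
    obtain ⟨v, hv, huv⟩ := S2 u hu
    have hop := opnorm_det (fun i => (ω i).1) T T2 (fun v hv => (c1 v hv).le)
    have l1 := lip_det (fun i => (ω i).1) (fun i => (ω i).2) hL hf hop (by linarith) u v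
    have l2 := lip_exp ν hL hN hf h0 ht h2 u v
    have l3 := c3 v hv
    rw [← hρ] at l2 ⊢
    have hLe : L * nrm (u - v) ≤ ε := by
      rw [le_div_iff₀ hL] at huv; linarith
    set su := ∑ i, f (dot u (ω i).1) * (ω i).2
    set sv := ∑ i, f (dot v (ω i).1) * (ω i).2
    set Eu := ∫ q, f (dot u q.1) * q.2 ∂ρ
    set Ev := ∫ q, f (dot v q.1) * q.2 ∂ρ
    have l1' : |su - sv| ≤ n * (80 * ε) := by
      refine l1.trans ?_
      calc _ = n * (80 * (L * nrm (u - v))) := by ring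
        _ ≤ _ := by gcongr
    have l2' : n * |Eu - Ev| ≤ n * (10 * ε) := by
      gcongr
      refine l2.trans ?_
      linarith
    have e : (1 / n : ℝ) * su - Eu = (su - n * Eu) / n := by field_simp
    rw [e, abs_div, abs_of_pos hn', div_le_iff₀ hn']
    have e2 : su - n * Eu = (su - sv) + (sv - n * Ev) - n * (Eu - Ev) := by ring
    rw [e2]
    refine (abs_sub _ _).trans ?_
    rw [abs_mul (n : ℝ), abs_of_pos hn']
    have := abs_add_le (su - sv) (sv - n * Ev)
    have hpos : 0 < n * ε := by positivity
    linarith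
  have h3 : (1 : ℝ) ≤ Q.real (goodSet n d f ν ε) + Q.real B1 + Q.real B2 + Q.real B3 := by
    calc (1 : ℝ) = Q.real Set.univ := by simp
      _ ≤ _ := measureReal_mono hcov
      _ ≤ _ := measureReal_union_le _ _
      _ ≤ _ := by
        gcongr
        refine (measureReal_union_le _ _).trans ?_
        gcongr
        exact measureReal_union_le _ _
  linarith

/-- **Lemma D.5**: let `f` be `L`-Lipschitz with compact support contained in `[-N, N]`; let
`X, X_1, …, X_n` be i.i.d. `N(0, I_d)` and `Y_1, …, Y_n` i.i.d. with `|Y| ≤ t` a.s. and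
`E[Y²] ≤ C`, independent of the `X`'s (modeled on the canonical product space, `ν` being the
common law of the `Y_i`).  Then for any `ε > 0`, with probability at least
`1 - C e^{Cd - cn} - C/n - 2(1 + 2L/ε)^d e^{-cnε²/(L²N²t²)}`,
`sup_{u ∈ S^{d-1}} |(1/n) Σ_i f(u^⊤X_i) Y_i - E[f(u^⊤X)Y]| ≤ Cε`. -/
theorem stmt17 :
    ∃ C > (0 : ℝ), ∃ c > (0 : ℝ),
      ∀ (n d : ℕ) (L N t : ℝ) (f : ℝ → ℝ) (ν : Measure ℝ), IsProbabilityMeasure ν →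
        0 < L → 0 < N → 0 < t →
        (∀ x y : ℝ, |f x - f y| ≤ L * |x - y|) →
        (∀ x : ℝ, N < |x| → f x = 0) →
        (∀ᵐ y ∂ν, |y| ≤ t) →
        (∫ y, y ^ 2 ∂ν) ≤ C →
        ∀ ε : ℝ, 0 < ε →
        1 - C * Real.exp (C * d - c * n) - C / n -
            2 * (1 + 2 * L / ε) ^ d *
              Real.exp (-c * n * ε ^ 2 / (L ^ 2 * N ^ 2 * t ^ 2)) ≤
          (((sample n d).prod (Measure.pi fun _ : Fin n => ν))
            {p | ∀ u : Fin d → ℝ, nrm u = 1 →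
              |(1 / n) * ∑ i, f (dot u (p.1 i)) * p.2 i -
                  ∫ q, f (dot u q.1) * q.2 ∂((stdGaussian d).prod ν)| ≤ C * ε}).toReal := by

  refine ⟨100, by norm_num, 1 / 4, by norm_num, ?_⟩
  intro n d L N t f ν hν hL hN ht0 hf h0 ht h2 ε hε
  have hM1 : (1 : ℝ) ≤ (1 + 2 * L / ε) ^ d :=
    one_le_pow₀ (by have : 0 < 2 * L / ε := by positivity
                    linarith)
  have hX0 := Real.exp_pos (-(1 / 4) * n * ε ^ 2 / (L ^ 2 * N ^ 2 * t ^ 2))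
  have hM0 : 0 ≤ 2 * (1 + 2 * L / ε) ^ d *
      Real.exp (-(1 / 4) * n * ε ^ 2 / (L ^ 2 * N ^ 2 * t ^ 2)) := by positivity
  have hO0 := Real.exp_pos (100 * d - 1 / 4 * n)
  rcases Nat.eq_zero_or_pos n with rfl | hn
  · refine le_trans ?_ ENNReal.toReal_nonneg
    have : (1 : ℝ) ≤ Real.exp (100 * d - 1 / 4 * (0 : ℕ)) := by
      rw [Real.one_le_exp_iff]; simp
    simp only [Nat.cast_zero, div_zero] at *
    linarith
  have hn' : (0 : ℝ) < n := by exact_mod_cast hn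
  have hdn : (0 : ℝ) ≤ 100 / n := by positivity
  have hmp := measurePreserving_arrowProdEquivProdArrow (Fin d → ℝ) ℝ (Fin n)
    (fun _ => _root_.stdGaussian d) (fun _ => ν)
  have hgoal : (((sample n d).prod (Measure.pi fun _ : Fin n => ν))
            {p | ∀ u : Fin d → ℝ, nrm u = 1 →
              |(1 / n) * ∑ i, f (dot u (p.1 i)) * p.2 i -
                  ∫ q, f (dot u q.1) * q.2 ∂((_root_.stdGaussian d).prod ν)| ≤ 100 * ε}).toReal =
      (Measure.pi fun _ : Fin n => (_root_.stdGaussian d).prod ν).real (goodSet n d f ν ε) := by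
    rw [sample, ← hmp.measure_preimage_equiv, measureReal_def]
    rfl
  rw [hgoal]
  rcases le_total (L * N) ε with hc | hc
  · have := case_large n d hn ν hL hN hf h0 ht h2 hc
    linarith
  · have h3 := case_small n d hn ν hL hN ht0 hf h0 ht h2 hε
    have hop : 5 ^ d * Real.exp (-(n / 2)) ≤ 100 * Real.exp (100 * d - 1 / 4 * n) := by
      have h5 : (5 : ℝ) ≤ Real.exp 100 := by
        have := Real.add_one_le_exp (100 : ℝ); linarith
      calc (5 : ℝ) ^ d * Real.exp (-(n / 2)) ≤ Real.exp 100 ^ d * Real.exp (-(n / 2)) := by gcongr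
        _ = Real.exp (100 * d - n / 2) := by
            rw [← Real.exp_nat_mul, ← Real.exp_add]; congr 1; ring
        _ ≤ Real.exp (100 * d - 1 / 4 * n) := Real.exp_le_exp.2 (by linarith)
        _ ≤ _ := by linarith
    set E := Real.exp (-(1 / 4) * n * ε ^ 2 / (L ^ 2 * N ^ 2 * t ^ 2)) with hE
    have hE1 : Real.exp (-(n * ε ^ 2 / (2 * (L * N * t) ^ 2))) = E ^ 2 := by
      rw [hE, ← Real.exp_nat_mul]; congr 1; push_cast; field_simp; norm_num
    have hE2 : Real.exp (-(200 * n / t ^ 2)) ≤ E ^ 2 := by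
      rw [← hE1, Real.exp_le_exp, neg_le_neg_iff, div_le_div_iff₀ (by positivity) (by positivity)]
      have : ε ^ 2 ≤ (L * N) ^ 2 := by gcongr
      have h4 : 0 < n * t ^ 2 := by positivity
      have h5 : 0 ≤ n * t ^ 2 * (L * N) ^ 2 := by positivity
      calc n * ε ^ 2 * t ^ 2 = n * t ^ 2 * ε ^ 2 := by ring
        _ ≤ n * t ^ 2 * (L * N) ^ 2 := by gcongr
        _ ≤ 400 * (n * t ^ 2 * (L * N) ^ 2) := by linarith
        _ = _ := by ring
    rw [hE1] at h3
    set M := (1 + 2 * L / ε) ^ d with hM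
    have hpi := measureReal_nonneg (μ := Measure.pi fun _ : Fin n => (_root_.stdGaussian d).prod ν)
      (s := goodSet n d f ν ε)
    by_cases hEs : E ≤ 2 / 3
    · have : E ^ 2 ≤ M * E ^ 2 := le_mul_of_one_le_left (by positivity) hM1
      have h6 : M * E ^ 2 ≤ M * E * (2 / 3) := by
        rw [pow_two, ← mul_assoc]; gcongr
      linarith
    · have : 2 / 3 ≤ M * E := by nlinarith
      linarith
end
end
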